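/- The set {e_1 ± e_2, e_1 ± e_3, e_2 ± e_3, Λe_1, Λe_2, Λe_3, Ke_4, M(e_1 ± e_2 ± e_3 ± e_4)} in ℝ⁴ with M ≠ 0 is a ∨-system if and only if Λ² = 2(2M² + 1) and K² = 2M²(2M² − 1)/(M² + 1). -/

import Mathlib

open Matrix
open scoped Classical

/-- The Gram matrix `G^A = Σ_i A_i ⊗ A_i` of a finite family of covectors on `ℝⁿ`. -/
noncomputable def gram {n : ℕ} {ι : Type*} [Fintype ι] (A : ι → Fin n → ℝ) :
    Matrix (Fin n) (Fin n) ℝ := ∑ i, vecMulVec (A i) (A i)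

/-- The vector `α^∨` dual to the covector `α` via the Gram form `G^A`. -/
noncomputable def vee {n : ℕ} {ι : Type*} [Fintype ι] (A : ι → Fin n → ℝ)
    (α : Fin n → ℝ) : Fin n → ℝ := (gram A)⁻¹ *ᵥ α

/-- `A` is a ∨-system: a finite spanning family of covectors with non-degenerate Gram
form such that for every two-dimensional plane `Pl ⊂ V*` and every member `A_i ∈ Pl`,
the vector `Σ_{A_j ∈ Pl} A_j(A_i^∨) • A_j^∨` is proportional to `A_i^∨`. -/
def IsVeeSystem {n : ℕ} {ι : Type*} [Fintype ι] (A : ι → Fin n → ℝ) : Prop :=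
  Submodule.span ℝ (Set.range A) = ⊤ ∧ IsUnit (gram A) ∧
    ∀ Pl : Submodule ℝ (Fin n → ℝ), Module.finrank ℝ Pl = 2 →
      ∀ i, A i ∈ Pl → ∃ lam : ℝ,
        ∑ j ∈ Finset.univ.filter (fun j => A j ∈ Pl),
          (A j ⬝ᵥ vee A (A i)) • vee A (A j) = lam • vee A (A i)

/-- The four-dimensional family: covectors `e_i ± e_j` (`1 ≤ i < j ≤ 3`), `Λ e_i`
(`1 ≤ i ≤ 3`), `K e_4`, and `M(e_1 ± e_2 ± e_3 ± e_4)` (all sign choices, taken up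
to overall sign by fixing the sign of `e_1` to be `+`). -/
def Tsystem (Λ K M : ℝ) :
    (({p : Fin 3 × Fin 3 // p.1 < p.2} × Bool) ⊕ Fin 3 ⊕ Unit ⊕
      {ε : Fin 4 → Bool // ε 0 = true}) → Fin 4 → ℝ :=
  fun k => match k with
  | Sum.inl (p, b) => fun t =>
      (if t = Fin.castSucc p.1.1 then 1 else 0) +
        (if t = Fin.castSucc p.1.2 then (if b then 1 else -1) else 0)
  | Sum.inr (Sum.inl i) => fun t => if t = Fin.castSucc i then Λ else 0
  | Sum.inr (Sum.inr (Sum.inl _)) => fun t => if t = 3 then K else 0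
  | Sum.inr (Sum.inr (Sum.inr ε)) => fun t => M * (if ε.1 t then 1 else -1)

/-- The index type of `Tsystem`. -/
abbrev TIndex : Type :=
  ({p : Fin 3 × Fin 3 // p.1 < p.2} × Bool) ⊕ Fin 3 ⊕ Unit ⊕ {ε : Fin 4 → Bool // ε 0 = true}

/-- The integral direction of a member of `Tsystem`, with its scalar factor removed. -/
def direction : TIndex → Fin 4 → ℤ
  | Sum.inl (p, b) => fun t =>
      (if t = Fin.castSucc p.1.1 then 1 else 0) +
        (if t = Fin.castSucc p.1.2 then (if b then 1 else -1) else 0)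
  | Sum.inr (Sum.inl i) => fun t => if t = Fin.castSucc i then 1 else 0
  | Sum.inr (Sum.inr (Sum.inl _)) => fun t => if t = 3 then 1 else 0
  | Sum.inr (Sum.inr (Sum.inr ε)) => fun t => if ε.1 t then 1 else -1

theorem direction_injective : Function.Injective direction := by
  rintro (k | k | k | k) (l | l | l | l) h
  · exact congrArg Sum.inl (by revert k l; decide +kernel)
  · exact absurd h (by revert k l; decide +kernel)
  · exact absurd h (by revert k l; decide +kernel)
  · exact absurd h (by revert k l; decide +kernel)
  · exact absurd h (by revert k l; decide +kernel)
  · exact congrArg (Sum.inr ∘ Sum.inl) (by revert k l; decide +kernel)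
  · exact absurd h (by revert k l; decide +kernel)
  · exact absurd h (by revert k l; decide +kernel)
  · exact absurd h (by revert k l; decide +kernel)
  · exact absurd h (by revert k l; decide +kernel)
  · rfl
  · exact absurd h (by revert k l; decide +kernel)
  · exact absurd h (by revert k l; decide +kernel)
  · exact absurd h (by revert k l; decide +kernel)
  · exact absurd h (by revert k l; decide +kernel)
  · refine congrArg (Sum.inr ∘ Sum.inr ∘ Sum.inr) (Subtype.ext (funext fun t => ?_))
    have ht := congrFun h t
    simp only [direction] at ht
    revert ht
    cases k.1 t <;> cases l.1 t <;> decide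

/-- All `2 × 2` minors of `(x, y)` vanish. -/
abbrev Collinear₂ {R : Type*} [CommRing R] (x y : Fin 4 → R) : Prop :=
  ∀ s t, x s * y t = x t * y s

/-- The `3 × 3` minor of `(x, y, z)` in the columns `s`, `t`, `u`. -/
def minor₃ {R : Type*} [CommRing R] (x y z : Fin 4 → R) (s t u : Fin 4) : R :=
  x s * (y t * z u - y u * z t) - x t * (y s * z u - y u * z s) + x u * (y s * z t - y t * z s)

/-- All `3 × 3` minors of `(x, y, z)` vanish. -/
abbrev Coplanar₃ {R : Type*} [CommRing R] (x y z : Fin 4 → R) : Prop :=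
  minor₃ x y z 0 1 2 = 0 ∧ minor₃ x y z 0 1 3 = 0 ∧ minor₃ x y z 0 2 3 = 0 ∧
    minor₃ x y z 1 2 3 = 0

theorem Coplanar₃.minor_eq_zero {R : Type*} [CommRing R] {x y z : Fin 4 → R}
    (h : Coplanar₃ x y z) (s t u : Fin 4) : minor₃ x y z s t u = 0 := by
  obtain ⟨h₁, h₂, h₃, h₄⟩ := h
  simp only [minor₃] at *
  fin_cases s <;> fin_cases t <;> fin_cases u <;>
    simp only [Fin.zero_eta, Fin.mk_one, Fin.reduceFinMk] <;>
    first
      | ring1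
      | linear_combination h₁
      | linear_combination -h₁
      | linear_combination h₂
      | linear_combination -h₂
      | linear_combination h₃
      | linear_combination -h₃
      | linear_combination h₄
      | linear_combination -h₄

/-- The part of the standard scalar product on the first three coordinates. -/
def dot₃ {R : Type*} [CommRing R] (x y : Fin 4 → R) : R := x 0 * y 0 + x 1 * y 1 + x 2 * y 2

/-- For the parameters of the theorem, the weight `c_k² ⟨n_k, n_i⟩` of the direction `n_k` with
scalar factor `c_k` is a multiple of `weightConst i k + M² * weightLin i k` by a constant. -/
def weightConst (i : TIndex) : TIndex → ℤ
  | Sum.inl k => dot₃ (direction (Sum.inl k)) (direction i)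
  | Sum.inr (Sum.inl k) => 2 * dot₃ (direction (Sum.inr (Sum.inl k))) (direction i)
  | Sum.inr (Sum.inr (Sum.inl _)) => -2 * direction i 3
  | Sum.inr (Sum.inr (Sum.inr ε)) =>
      direction (Sum.inr (Sum.inr (Sum.inr ε))) 3 * direction i 3

/-- The coefficient of `M²` in the weight described at `weightConst`. -/
def weightLin (i : TIndex) : TIndex → ℤ
  | Sum.inl _ => 0
  | Sum.inr (Sum.inl k) => 4 * dot₃ (direction (Sum.inr (Sum.inl k))) (direction i)
  | Sum.inr (Sum.inr (Sum.inl _)) => 4 * direction i 3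
  | Sum.inr (Sum.inr (Sum.inr ε)) =>
      dot₃ (direction (Sum.inr (Sum.inr (Sum.inr ε)))) (direction i) +
      direction (Sum.inr (Sum.inr (Sum.inr ε))) 3 * direction i 3

/-- The first coordinate at which `direction i` is nonzero; its value there is `1`. -/
def pivot : TIndex → Fin 4
  | Sum.inl (p, _) => Fin.castSucc p.1.1
  | Sum.inr (Sum.inl i) => Fin.castSucc i
  | Sum.inr (Sum.inr (Sum.inl _)) => 3
  | Sum.inr (Sum.inr (Sum.inr _)) => 0

theorem direction_pivot : ∀ i, direction i (pivot i) = 1 := by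
  decide +kernel

theorem weight_proportional : ∀ i j, ¬ Collinear₂ (direction i) (direction j) →
    ∀ t,
      (∑ k with Coplanar₃ (direction i) (direction j) (direction k),
          weightConst i k * direction k t =
        (∑ k with Coplanar₃ (direction i) (direction j) (direction k),
          weightConst i k * direction k (pivot i)) * direction i t) ∧
      (∑ k with Coplanar₃ (direction i) (direction j) (direction k),
          weightLin i k * direction k t =
        (∑ k with Coplanar₃ (direction i) (direction j) (direction k),
          weightLin i k * direction k (pivot i)) * direction i t) := by
  decide +kernel

theorem gram_mulVec {n : ℕ} {ι : Type*} [Fintype ι] (A : ι → Fin n → ℝ) (v : Fin n → ℝ) :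
    gram A *ᵥ v = ∑ i, (A i ⬝ᵥ v) • A i := by
  simp [_root_.gram, Matrix.sum_mulVec, vecMulVec_mulVec]

theorem gram_mulVec_vee {n : ℕ} {ι : Type*} [Fintype ι] {A : ι → Fin n → ℝ}
    (h : IsUnit (gram A)) (v : Fin n → ℝ) : gram A *ᵥ vee A v = v := by
  rw [vee, mulVec_mulVec, Matrix.mul_nonsing_inv _ ((Matrix.isUnit_iff_isUnit_det _).1 h),
    one_mulVec]

theorem span_range_eq_top_of_isUnit_gram {n : ℕ} {ι : Type*} [Fintype ι] {A : ι → Fin n → ℝ}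
    (h : IsUnit (gram A)) : Submodule.span ℝ (Set.range A) = ⊤ := by
  refine eq_top_iff.2 fun v _ => ?_
  rw [← gram_mulVec_vee h v, gram_mulVec]
  exact Submodule.sum_mem _ fun i _ =>
    Submodule.smul_mem _ _ (Submodule.subset_span (Set.mem_range_self i))

/-- The dual vectors in the ∨-condition can be traded for the covectors themselves. -/
theorem sum_smul_vee_eq_iff {n : ℕ} {ι : Type*} [Fintype ι] {A : ι → Fin n → ℝ}
    (h : IsUnit (gram A)) (s : Finset ι) (c : ι → ℝ) (lam : ℝ) (v : Fin n → ℝ) :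
    ∑ j ∈ s, c j • vee A (A j) = lam • vee A v ↔ ∑ j ∈ s, c j • A j = lam • v := by
  have h₁ : ∑ j ∈ s, c j • vee A (A j) = vee A (∑ j ∈ s, c j • A j) := by
    simp [vee, mulVec_sum, mulVec_smul]
  have h₂ : lam • vee A v = vee A (lam • v) := by simp [vee, mulVec_smul]
  rw [h₁, h₂]
  exact ⟨fun e => by rw [← gram_mulVec_vee h (∑ j ∈ s, c j • A j), e, gram_mulVec_vee h],
    fun e => by rw [e]⟩

theorem exists_smul_eq_of_collinear {x y : Fin 4 → ℝ} (h : Collinear₂ x y) {s : Fin 4}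
    (hs : x s ≠ 0) : ∃ c : ℝ, c • x = y :=
  ⟨y s / x s, funext fun t => by
    have := h s t
    simp only [Pi.smul_apply, smul_eq_mul]
    field_simp
    linarith⟩

theorem linearIndependent_pair_of_not_collinear {x y : Fin 4 → ℝ} (h : ¬ Collinear₂ x y) :
    LinearIndependent ℝ ![x, y] := by
  rw [LinearIndependent.pair_iff]
  intro a b e
  have e' : ∀ t, a * x t + b * y t = 0 := fun t => by simpa using congrFun e t
  simp only [Collinear₂, not_forall] at h
  obtain ⟨s, t, hst⟩ := h
  have hst' : x s * y t - x t * y s ≠ 0 := sub_ne_zero.2 hst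
  constructor
  · refine (mul_eq_zero.1 ?_).resolve_right hst'
    linear_combination y t * e' s - y s * e' t
  · refine (mul_eq_zero.1 ?_).resolve_right hst'
    linear_combination x s * e' t - x t * e' s

theorem finrank_span_pair_of_not_collinear {x y : Fin 4 → ℝ} (h : ¬ Collinear₂ x y) :
    Module.finrank ℝ (Submodule.span ℝ {x, y}) = 2 := by
  have := finrank_span_eq_card (linearIndependent_pair_of_not_collinear h)
  rwa [Matrix.range_cons_cons_empty, Fintype.card_fin] at this

theorem mem_iff_coplanar {Pl : Submodule ℝ (Fin 4 → ℝ)} (hPl : Module.finrank ℝ Pl = 2)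
    {x y : Fin 4 → ℝ} (hx : x ∈ Pl) (hy : y ∈ Pl) (h : ¬ Collinear₂ x y) (z : Fin 4 → ℝ) :
    z ∈ Pl ↔ Coplanar₃ x y z := by
  constructor
  · intro hz
    have hspan : Submodule.span ℝ {x, y} = Pl :=
      Submodule.eq_of_le_of_finrank_eq (Submodule.span_le.2 (Set.pair_subset hx hy))
        ((finrank_span_pair_of_not_collinear h).trans hPl.symm)
    rw [← hspan, Submodule.mem_span_pair] at hz
    obtain ⟨a, b, rfl⟩ := hz
    simp only [Coplanar₃, minor₃, Pi.add_apply, Pi.smul_apply, smul_eq_mul]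
    refine ⟨?_, ?_, ?_, ?_⟩ <;> ring
  · intro hz
    simp only [Collinear₂, not_forall] at h
    obtain ⟨s, t, hst⟩ := h
    rw [← Submodule.smul_mem_iff Pl (sub_ne_zero.2 hst)]
    have : (x s * y t - x t * y s) • z =
        (z s * y t - z t * y s) • x + (x s * z t - x t * z s) • y := by
      funext u
      have := hz.minor_eq_zero s t u
      simp only [minor₃] at this
      simp only [Pi.add_apply, Pi.smul_apply, smul_eq_mul]
      linear_combination this
    rw [this]
    exact Pl.add_mem (Pl.smul_mem _ hx) (Pl.smul_mem _ hy)

/-- The scalar factor of a member of `Tsystem`. -/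
def scale (Λ K M : ℝ) : TIndex → ℝ
  | Sum.inl _ => 1
  | Sum.inr (Sum.inl _) => Λ
  | Sum.inr (Sum.inr (Sum.inl _)) => K
  | Sum.inr (Sum.inr (Sum.inr _)) => M

/-- The direction of a member of `Tsystem` as a real covector. -/
def realDirection (k : TIndex) : Fin 4 → ℝ := fun t => direction k t

theorem Tsystem_eq_smul (Λ K M : ℝ) (k : TIndex) :
    Tsystem Λ K M k = scale Λ K M k • realDirection k := by
  funext t
  rcases k with ⟨p, b⟩ | i | _ | ε <;>
    simp [Tsystem, scale, realDirection, direction]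

theorem collinear_realDirection_iff (i j : TIndex) :
    Collinear₂ (realDirection i) (realDirection j) ↔ Collinear₂ (direction i) (direction j) := by
  simp only [Collinear₂, realDirection]
  norm_cast

theorem coplanar_realDirection_iff (i j k : TIndex) :
    Coplanar₃ (realDirection i) (realDirection j) (realDirection k) ↔
      Coplanar₃ (direction i) (direction j) (direction k) := by
  simp only [Coplanar₃, minor₃, realDirection]
  norm_cast

theorem gram_Tsystem (Λ K M : ℝ) :
    gram (Tsystem Λ K M) = diagonal fun t =>
      if t = 3 then K ^ 2 + 8 * M ^ 2 else Λ ^ 2 + 8 * M ^ 2 + 4 := by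
  have h₁ : ∀ s t, ∑ x, direction (Sum.inl x) s * direction (Sum.inl x) t =
      if s = t then (if s = 3 then 0 else 4) else 0 := by decide +kernel
  have h₂ : ∀ s t, ∑ x, direction (Sum.inr (Sum.inl x)) s * direction (Sum.inr (Sum.inl x)) t =
      if s = t then (if s = 3 then 0 else 1) else 0 := by decide +kernel
  have h₃ : ∀ s t, ∑ x, direction (Sum.inr (Sum.inr (Sum.inl x))) s *
      direction (Sum.inr (Sum.inr (Sum.inl x))) t =
      if s = t then (if s = 3 then 1 else 0) else 0 := by decide +kernel
  have h₄ : ∀ s t, ∑ x, direction (Sum.inr (Sum.inr (Sum.inr x))) s *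
      direction (Sum.inr (Sum.inr (Sum.inr x))) t = if s = t then 8 else 0 := by decide +kernel
  ext s t
  have e : ∀ k : TIndex, vecMulVec (Tsystem Λ K M k) (Tsystem Λ K M k) s t =
      scale Λ K M k ^ 2 * ((direction k s * direction k t : ℤ) : ℝ) := fun k => by
    rw [Tsystem_eq_smul, vecMulVec_apply]
    simp only [realDirection, Pi.smul_apply, smul_eq_mul]
    push_cast
    ring
  rw [_root_.gram, Matrix.sum_apply]
  simp only [e, Fintype.sum_sum_type (α₁ := {p : Fin 3 × Fin 3 // p.1 < p.2} × Bool),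
    Fintype.sum_sum_type (α₁ := Fin 3), Fintype.sum_sum_type (α₁ := Unit), scale,
    ← Finset.mul_sum, ← Int.cast_sum]
  rw [h₁, h₂, h₃, h₄, diagonal_apply]
  split_ifs <;> push_cast <;> ring

/-- The Gram pairing of two directions. -/
noncomputable def gramPairing (Λ K M : ℝ) (k i : TIndex) : ℝ :=
  dot₃ (realDirection k) (realDirection i) / (Λ ^ 2 + 8 * M ^ 2 + 4) +
    realDirection k 3 * realDirection i 3 / (K ^ 2 + 8 * M ^ 2)

theorem isUnit_gram_Tsystem (Λ K : ℝ) {M : ℝ} (hM : M ≠ 0) : IsUnit (gram (Tsystem Λ K M)) := by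
  rw [gram_Tsystem, isUnit_diagonal, Pi.isUnit_iff]
  intro t
  split_ifs
  · exact (by positivity : K ^ 2 + 8 * M ^ 2 ≠ 0).isUnit
  · exact (by positivity : Λ ^ 2 + 8 * M ^ 2 + 4 ≠ 0).isUnit

theorem dotProduct_vee_Tsystem (Λ K : ℝ) {M : ℝ} (hM : M ≠ 0) (k i : TIndex) :
    Tsystem Λ K M k ⬝ᵥ vee (Tsystem Λ K M) (Tsystem Λ K M i) =
      scale Λ K M k * scale Λ K M i * gramPairing Λ K M k i := by
  have ha : Λ ^ 2 + 8 * M ^ 2 + 4 ≠ 0 := by positivity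
  have hb : K ^ 2 + 8 * M ^ 2 ≠ 0 := by positivity
  have h := gram_mulVec_vee (isUnit_gram_Tsystem Λ K hM) (Tsystem Λ K M i)
  rw [gram_Tsystem] at h
  generalize vee (Tsystem Λ K M) (Tsystem Λ K M i) = w at h
  have h' : ∀ t, w t = scale Λ K M i * realDirection i t /
      (if t = 3 then K ^ 2 + 8 * M ^ 2 else Λ ^ 2 + 8 * M ^ 2 + 4) := fun t => by
    have := congrFun h t
    rw [mulVec_diagonal, Tsystem_eq_smul, Pi.smul_apply, smul_eq_mul] at this
    rw [← this]
    split_ifs <;> field_simp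
  simp only [dotProduct, Fin.sum_univ_four, h', Tsystem_eq_smul Λ K M k, Pi.smul_apply,
    smul_eq_mul, gramPairing, dot₃]
  simp only [Fin.isValue, Fin.reduceEq, if_false, if_true]
  ring

theorem sum_plane_Tsystem (Λ K : ℝ) {M : ℝ} (hM : M ≠ 0) {Pl : Submodule ℝ (Fin 4 → ℝ)}
    (hPl : Module.finrank ℝ Pl = 2) {i j : TIndex} (hi : realDirection i ∈ Pl)
    (hj : realDirection j ∈ Pl) (hij : ¬ Collinear₂ (direction i) (direction j)) :
    ∑ k with Tsystem Λ K M k ∈ Pl,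
        (Tsystem Λ K M k ⬝ᵥ vee (Tsystem Λ K M) (Tsystem Λ K M i)) • Tsystem Λ K M k =
      scale Λ K M i • ∑ k with Coplanar₃ (direction i) (direction j) (direction k),
        (scale Λ K M k ^ 2 * gramPairing Λ K M k i) • realDirection k := by
  rw [Finset.smul_sum, Finset.sum_filter, Finset.sum_filter]
  refine Finset.sum_congr rfl fun k _ => ?_
  have hk : realDirection k ∈ Pl ↔ Coplanar₃ (direction i) (direction j) (direction k) := by
    rw [← coplanar_realDirection_iff]
    exact mem_iff_coplanar hPl hi hj (mt (collinear_realDirection_iff i j).1 hij) _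
  rw [dotProduct_vee_Tsystem Λ K hM, Tsystem_eq_smul Λ K M k]
  by_cases hc : scale Λ K M k = 0
  · simp [hc]
  · simp only [Submodule.smul_mem_iff Pl hc, hk, smul_smul]
    congr 2
    ring

theorem sum_coplanar_eq_smul {Λ K M : ℝ} (hM : M ≠ 0) (h : IsVeeSystem (Tsystem Λ K M))
    {i j : TIndex} (hi : scale Λ K M i ≠ 0) (hij : ¬ Collinear₂ (direction i) (direction j)) :
    ∃ lam : ℝ, ∑ k with Coplanar₃ (direction i) (direction j) (direction k),
        (scale Λ K M k ^ 2 * gramPairing Λ K M k i) • realDirection k =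
      lam • realDirection i := by
  have hij' := mt (collinear_realDirection_iff i j).1 hij
  have hPl := finrank_span_pair_of_not_collinear hij'
  have hmi : realDirection i ∈ Submodule.span ℝ {realDirection i, realDirection j} :=
    Submodule.subset_span (Set.mem_insert _ _)
  have hmj : realDirection j ∈ Submodule.span ℝ {realDirection i, realDirection j} :=
    Submodule.subset_span (Set.mem_insert_of_mem _ rfl)
  obtain ⟨lam, hlam⟩ := h.2.2 _ hPl i (by
    rw [Tsystem_eq_smul]
    exact Submodule.smul_mem _ _ hmi)
  rw [sum_smul_vee_eq_iff h.2.1, sum_plane_Tsystem Λ K hM hPl hmi hmj hij, Tsystem_eq_smul,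
    smul_comm lam] at hlam
  exact ⟨lam, smul_right_injective _ hi hlam⟩

theorem parameters_of_isVeeSystem {Λ K M : ℝ} (hM : M ≠ 0) (h : IsVeeSystem (Tsystem Λ K M)) :
    (M ^ 2 + 1) * (K ^ 2 + 8 * M ^ 2) = M ^ 2 * (Λ ^ 2 + 8 * M ^ 2 + 4) ∧
      Λ ^ 2 * (K ^ 2 + 8 * M ^ 2) =
        2 * M ^ 2 * (K ^ 2 + 8 * M ^ 2) + 2 * M ^ 2 * (Λ ^ 2 + 8 * M ^ 2 + 4) := by
  have ha : Λ ^ 2 + 8 * M ^ 2 + 4 ≠ 0 := by positivity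
  have hb : K ^ 2 + 8 * M ^ 2 ≠ 0 := by positivity
  let full : TIndex := Sum.inr (Sum.inr (Sum.inr ⟨![true, true, true, true], rfl⟩))
  let root : TIndex := Sum.inl (⟨(0, 1), by decide⟩, true)
  let axis : TIndex := Sum.inr (Sum.inl 0)
  have hfull : scale Λ K M full ≠ 0 := hM
  have vfull : direction full = ![1, 1, 1, 1] := by decide +kernel
  have vroot : direction root = ![1, 1, 0, 0] := by decide +kernel
  have vaxis : direction axis = ![1, 0, 0, 0] := by decide +kernel
  constructor
  · obtain ⟨lam, hlam⟩ := sum_coplanar_eq_smul hM h hfull (j := root) (by decide +kernel)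
    let other : TIndex := Sum.inr (Sum.inr (Sum.inr ⟨![true, true, false, false], rfl⟩))
    have vother : direction other = ![1, 1, -1, -1] := by decide +kernel
    have hmem : ∀ k, Coplanar₃ (direction full) (direction root) (direction k) ↔
        direction k = direction full ∨ direction k = direction root ∨
          direction k = direction other := by decide +kernel
    have hset : (Finset.univ.filter fun k =>
        Coplanar₃ (direction full) (direction root) (direction k)) = {full, root, other} := by
      ext k
      simp only [Finset.mem_filter_univ, hmem, Finset.mem_insert, Finset.mem_singleton,
        direction_injective.eq_iff]
    have hfr : full ≠ root := ne_of_apply_ne direction (by decide +kernel)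
    have hfo : full ≠ other := ne_of_apply_ne direction (by decide +kernel)
    have hro : root ≠ other := ne_of_apply_ne direction (by decide +kernel)
    rw [hset, Finset.sum_insert (by simp [hfr, hfo]), Finset.sum_insert (by simp [hro]),
      Finset.sum_singleton] at hlam
    have e₀ := congrFun hlam 0
    have e₃ := congrFun hlam 3
    simp only [Pi.add_apply, Pi.smul_apply, gramPairing, dot₃, realDirection, vfull, vroot,
      vother, smul_eq_mul, show scale Λ K M full = M from rfl,
      show scale Λ K M root = 1 from rfl, show scale Λ K M other = M from rfl] at e₀ e₃
    simp at e₀ e₃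
    rw [← e₃] at e₀
    field_simp at e₀
    linarith
  · obtain ⟨lam, hlam⟩ := sum_coplanar_eq_smul hM h hfull (j := axis) (by decide +kernel)
    let other : TIndex := Sum.inr (Sum.inr (Sum.inr ⟨![true, false, false, false], rfl⟩))
    have vother : direction other = ![1, -1, -1, -1] := by decide +kernel
    have hmem : ∀ k, Coplanar₃ (direction full) (direction axis) (direction k) ↔
        direction k = direction full ∨ direction k = direction axis ∨
          direction k = direction other := by decide +kernel
    have hset : (Finset.univ.filter fun k =>
        Coplanar₃ (direction full) (direction axis) (direction k)) = {full, axis, other} := by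
      ext k
      simp only [Finset.mem_filter_univ, hmem, Finset.mem_insert, Finset.mem_singleton,
        direction_injective.eq_iff]
    have hfr : full ≠ axis := ne_of_apply_ne direction (by decide +kernel)
    have hfo : full ≠ other := ne_of_apply_ne direction (by decide +kernel)
    have hro : axis ≠ other := ne_of_apply_ne direction (by decide +kernel)
    rw [hset, Finset.sum_insert (by simp [hfr, hfo]), Finset.sum_insert (by simp [hro]),
      Finset.sum_singleton] at hlam
    have e₀ := congrFun hlam 0
    have e₃ := congrFun hlam 3
    simp only [Pi.add_apply, Pi.smul_apply, gramPairing, dot₃, realDirection, vfull, vaxis,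
      vother, smul_eq_mul, show scale Λ K M full = M from rfl,
      show scale Λ K M axis = Λ from rfl, show scale Λ K M other = M from rfl] at e₀ e₃
    simp at e₀ e₃
    rw [← e₃] at e₀
    field_simp at e₀
    linarith

theorem sq_scale_mul_gramPairing {Λ K M : ℝ} (hM : M ≠ 0)
    (hΛ : Λ ^ 2 = 2 * (2 * M ^ 2 + 1))
    (hK : K ^ 2 = 2 * M ^ 2 * (2 * M ^ 2 - 1) / (M ^ 2 + 1)) (k i : TIndex) :
    scale Λ K M k ^ 2 * gramPairing Λ K M k i =
      (weightConst i k + M ^ 2 * weightLin i k) / (12 * M ^ 2 + 6) := by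
  have h₁ : M ^ 2 + 1 ≠ 0 := by positivity
  have h₂ : 2 * M ^ 2 + 1 ≠ 0 := by positivity
  have ha : Λ ^ 2 + 8 * M ^ 2 + 4 = 6 * (2 * M ^ 2 + 1) := by rw [hΛ]; ring
  have hb : K ^ 2 + 8 * M ^ 2 = 6 * M ^ 2 * (2 * M ^ 2 + 1) / (M ^ 2 + 1) := by
    rw [hK]; field_simp; ring
  have h6 : 12 * M ^ 2 + 6 = 6 * (2 * M ^ 2 + 1) := by ring
  rw [gramPairing, ha, hb, h6]
  rcases k with k | k | k | k
  · have h3 : realDirection (Sum.inl k) 3 = 0 := by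
      have : ∀ k, direction (Sum.inl k) 3 = 0 := by decide
      simp [realDirection, this]
    rw [h3]
    simp only [scale, weightConst, weightLin, dot₃, realDirection]
    push_cast
    field_simp
    ring
  · have h3 : realDirection (Sum.inr (Sum.inl k)) 3 = 0 := by
      have : ∀ k, direction (Sum.inr (Sum.inl k)) 3 = 0 := by decide
      simp [realDirection, this]
    rw [h3]
    simp only [scale, weightConst, weightLin, dot₃, realDirection, hΛ]
    push_cast
    field_simp
    ring
  · have h3 : realDirection (Sum.inr (Sum.inr (Sum.inl k))) = ![0, 0, 0, 1] := by
      funext t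
      fin_cases t <;> simp [realDirection, direction]
    rw [h3]
    simp only [scale, weightConst, weightLin, dot₃, realDirection, hK]
    simp
    field_simp
    ring
  · simp only [scale, weightConst, weightLin, dot₃, realDirection]
    push_cast
    field_simp
    ring

theorem sum_coplanar_proportional {Λ K M : ℝ} (hM : M ≠ 0)
    (hΛ : Λ ^ 2 = 2 * (2 * M ^ 2 + 1))
    (hK : K ^ 2 = 2 * M ^ 2 * (2 * M ^ 2 - 1) / (M ^ 2 + 1)) {i j : TIndex}
    (hij : ¬ Collinear₂ (direction i) (direction j)) :
    ∃ lam : ℝ, ∑ k with Coplanar₃ (direction i) (direction j) (direction k),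
        (scale Λ K M k ^ 2 * gramPairing Λ K M k i) • realDirection k =
      lam • realDirection i := by
  have key : ∀ t, (∑ k with Coplanar₃ (direction i) (direction j) (direction k),
        (scale Λ K M k ^ 2 * gramPairing Λ K M k i) • realDirection k) t =
      (((∑ k with Coplanar₃ (direction i) (direction j) (direction k),
          weightConst i k * direction k t : ℤ) : ℝ) +
        M ^ 2 * ((∑ k with Coplanar₃ (direction i) (direction j) (direction k),
          weightLin i k * direction k t : ℤ) : ℝ)) / (12 * M ^ 2 + 6) := fun t => by
    push_cast
    rw [Finset.sum_apply, Finset.mul_sum, ← Finset.sum_add_distrib, Finset.sum_div]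
    refine Finset.sum_congr rfl fun k _ => ?_
    rw [Pi.smul_apply, sq_scale_mul_gramPairing hM hΛ hK, smul_eq_mul, realDirection]
    ring
  refine ⟨(∑ k with Coplanar₃ (direction i) (direction j) (direction k),
    (scale Λ K M k ^ 2 * gramPairing Λ K M k i) • realDirection k) (pivot i), funext fun t => ?_⟩
  rw [Pi.smul_apply, smul_eq_mul, key t, key (pivot i), (weight_proportional i j hij t).1,
    (weight_proportional i j hij t).2, realDirection]
  push_cast
  ring

theorem isVeeSystem_Tsystem {Λ K M : ℝ} (hM : M ≠ 0) (hΛ : Λ ^ 2 = 2 * (2 * M ^ 2 + 1))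
    (hK : K ^ 2 = 2 * M ^ 2 * (2 * M ^ 2 - 1) / (M ^ 2 + 1)) :
    IsVeeSystem (Tsystem Λ K M) := by
  have hG := isUnit_gram_Tsystem Λ K hM
  refine ⟨span_range_eq_top_of_isUnit_gram hG, hG, fun Pl hPl i hi => ?_⟩
  simp only [sum_smul_vee_eq_iff hG]
  by_cases hc : scale Λ K M i = 0
  · refine ⟨0, ?_⟩
    simp [dotProduct_vee_Tsystem Λ K hM, hc]
  rw [Tsystem_eq_smul, Submodule.smul_mem_iff Pl hc] at hi
  by_cases hj : ∃ j, realDirection j ∈ Pl ∧ ¬ Collinear₂ (direction i) (direction j)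
  · obtain ⟨j, hj, hij⟩ := hj
    obtain ⟨lam, hlam⟩ := sum_coplanar_proportional hM hΛ hK hij
    exact ⟨lam, by
      rw [sum_plane_Tsystem Λ K hM hPl hi hj hij, hlam, Tsystem_eq_smul, smul_comm]⟩
  · push Not at hj
    have hmem : ∑ k with Tsystem Λ K M k ∈ Pl,
        (Tsystem Λ K M k ⬝ᵥ vee (Tsystem Λ K M) (Tsystem Λ K M i)) • Tsystem Λ K M k ∈
        Submodule.span ℝ {Tsystem Λ K M i} := by
      refine Submodule.sum_mem _ fun k hk => Submodule.smul_mem _ _ ?_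
      have hk := (Finset.mem_filter.1 hk).2
      rw [Tsystem_eq_smul] at hk
      rw [Tsystem_eq_smul Λ K M k, Tsystem_eq_smul Λ K M i,
        Submodule.span_singleton_smul_eq (Ne.isUnit hc)]
      by_cases hck : scale Λ K M k = 0
      · simp [hck]
      rw [Submodule.smul_mem_iff Pl hck] at hk
      have hcol := (collinear_realDirection_iff i k).2 (hj k hk)
      obtain ⟨c, hc⟩ := exists_smul_eq_of_collinear hcol (s := pivot i)
        (by simp [realDirection, direction_pivot])
      exact Submodule.smul_mem _ _ (Submodule.mem_span_singleton.2 ⟨c, hc⟩)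
    obtain ⟨lam, hlam⟩ := Submodule.mem_span_singleton.1 hmem
    exact ⟨lam, hlam.symm⟩

/-- for `M ≠ 0`, the set
`{e_1 ± e_2, e_1 ± e_3, e_2 ± e_3, Λe_1, Λe_2, Λe_3, Ke_4, M(e_1 ± e_2 ± e_3 ± e_4)}`
in `ℝ⁴` is a ∨-system if and only if `Λ² = 2(2M² + 1)` and
`K² = 2M²(2M² − 1)/(M² + 1)`. -/
theorem Tsystem_isVeeSystem_iff (Λ K M : ℝ) (hM : M ≠ 0) :
    IsVeeSystem (Tsystem Λ K M) ↔
      (Λ ^ 2 = 2 * (2 * M ^ 2 + 1) ∧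
        K ^ 2 = 2 * M ^ 2 * (2 * M ^ 2 - 1) / (M ^ 2 + 1)) := by
  refine ⟨fun h => ?_, fun h => isVeeSystem_Tsystem hM h.1 h.2⟩
  obtain ⟨h₁, h₂⟩ := parameters_of_isVeeSystem hM h
  have hb : K ^ 2 + 8 * M ^ 2 ≠ 0 := by positivity
  have hΛ : Λ ^ 2 = 2 * (2 * M ^ 2 + 1) := by
    apply mul_right_cancel₀ hb
    linear_combination h₂ - 2 * h₁
  refine ⟨hΛ, ?_⟩
  rw [eq_div_iff (by positivity)]
  rw [hΛ] at h₁
  linear_combination h₁
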